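/- With the notation of the encoding/measurement setup, consider the joint ensemble {p_{if}, ρ_f^•} indexed by pairs (α,ω) with probabilities p_{if}(α,ω) and states ρ_f^α(ω) (whose average state is η_f), the ensemble {p_f, ρ_f} (also with average η_f), and for each ω with p_f(ω) > 0 the conditional ensemble {p_{i|f}(·|ω), ρ_f^•(ω)} (with average ρ_f(ω)). Then the identity χ{p_{if}, ρ_f^•} = χ{p_f, ρ_f} + Σ_{ω: p_f(ω)>0} p_f(ω) χ{p_{i|f}(·|ω), ρ_f^•(ω)} holds. -/

import Mathlib

open Matrix Finset
open scoped BigOperators ComplexOrder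

noncomputable section

/-- Matrix logarithm of a Hermitian matrix via the spectral decomposition
(with the convention `Real.log 0 = 0` on the kernel); `0` for non-Hermitian matrices. -/
def matLog {d : ℕ} (A : Matrix (Fin d) (Fin d) ℂ) : Matrix (Fin d) (Fin d) ℂ :=
  if hA : A.IsHermitian then
    (hA.eigenvectorUnitary : Matrix (Fin d) (Fin d) ℂ) *
      Matrix.diagonal (fun i => (Real.log (hA.eigenvalues i) : ℂ)) *
      star (hA.eigenvectorUnitary : Matrix (Fin d) (Fin d) ℂ)
  else 0

/-- The von Neumann entropy `S_q(ρ) = −Tr(ρ log ρ)`. -/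
def vnEntropy {d : ℕ} (ρ : Matrix (Fin d) (Fin d) ℂ) : ℝ :=
  -(Matrix.trace (ρ * matLog ρ)).re

/-- The quantum relative entropy `S_q(ρ‖φ) = Tr(ρ (log ρ − log φ))`. -/
def qRelEntropy {d : ℕ} (ρ φ : Matrix (Fin d) (Fin d) ℂ) : ℝ :=
  (Matrix.trace (ρ * (matLog ρ - matLog φ))).re

/-- The classical relative entropy `S_c(p‖q) = Σ_{ω : p ω > 0} p ω log (p ω / q ω)`. -/
def cRelEntropy {Ω : Type*} [Fintype Ω] (p q : Ω → ℝ) : ℝ :=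
  ∑ ω ∈ Finset.univ.filter (fun ω => 0 < p ω), p ω * Real.log (p ω / q ω)

/-- The probability of outcome `ω` for POV measure `E` in the state `ρ`. -/
def povProb {d : ℕ} {Ω : Type*} (E : Ω → Matrix (Fin d) (Fin d) ℂ)
    (ρ : Matrix (Fin d) (Fin d) ℂ) (ω : Ω) : ℝ :=
  (Matrix.trace (E ω * ρ)).re

/-- The χ-quantity of the ensemble `{p, σ}` (relative entropies w.r.t. the average state). -/
def chiQuantity {d : ℕ} {X : Type*} [Fintype X] (p : X → ℝ)
    (σ : X → Matrix (Fin d) (Fin d) ℂ) : ℝ :=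
  ∑ x ∈ Finset.univ.filter (fun x => 0 < p x),
    p x * qRelEntropy (σ x) (∑ y, p y • σ y)

/-- The operation `O(ω)[ρ] = Σ_k V_k^ω ρ (V_k^ω)†` of the instrument with Kraus family `V`. -/
def instrOp {d : ℕ} {Ω K : Type*} [Fintype K] (V : Ω → K → Matrix (Fin d) (Fin d) ℂ)
    (ω : Ω) (ρ : Matrix (Fin d) (Fin d) ℂ) : Matrix (Fin d) (Fin d) ℂ :=
  ∑ k, V ω k * ρ * (V ω k)ᴴ

/-- The POV measure `E(ω) = Σ_k (V_k^ω)† V_k^ω` associated with the instrument `V`. -/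
def instrPOV {d : ℕ} {Ω K : Type*} [Fintype K] (V : Ω → K → Matrix (Fin d) (Fin d) ℂ)
    (ω : Ω) : Matrix (Fin d) (Fin d) ℂ :=
  ∑ k, (V ω k)ᴴ * V ω k

/-- The outcome probability `p_ρ(ω) = Tr(E(ω) ρ)` of the instrument `V`. -/
def outcomeProb {d : ℕ} {Ω K : Type*} [Fintype K] (V : Ω → K → Matrix (Fin d) (Fin d) ℂ)
    (ρ : Matrix (Fin d) (Fin d) ℂ) (ω : Ω) : ℝ :=
  (Matrix.trace (instrPOV V ω * ρ)).re

/-- The a posteriori state `π_ρ(ω) = O(ω)[ρ] / p_ρ(ω)` of the instrument `V`. -/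
def postState {d : ℕ} {Ω K : Type*} [Fintype K] (V : Ω → K → Matrix (Fin d) (Fin d) ℂ)
    (ρ : Matrix (Fin d) (Fin d) ℂ) (ω : Ω) : Matrix (Fin d) (Fin d) ℂ :=
  (outcomeProb V ρ ω)⁻¹ • instrOp V ω ρ

/-- The classical input/output mutual information `I_c{p, ρ; E}` for the ensemble `{p, ρ}`
measured with the POV measure `E`. -/
def mutualInfo {d : ℕ} {A Ω : Type*} [Fintype A] [Fintype Ω]
    (p : A → ℝ) (ρ : A → Matrix (Fin d) (Fin d) ℂ)
    (E : Ω → Matrix (Fin d) (Fin d) ℂ) : ℝ :=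
  ∑ x ∈ Finset.univ.filter (fun x : A × Ω => 0 < p x.1 * povProb E (ρ x.1) x.2),
    (p x.1 * povProb E (ρ x.1) x.2) *
      Real.log ((p x.1 * povProb E (ρ x.1) x.2) /
        (p x.1 * povProb E (∑ α, p α • ρ α) x.2))

/-- The quantum information gain `I_q(ρ; I)` of the instrument `V` on the state `ρ`. -/
def infoGain {d : ℕ} {Ω K : Type*} [Fintype Ω] [Fintype K]
    (V : Ω → K → Matrix (Fin d) (Fin d) ℂ) (ρ : Matrix (Fin d) (Fin d) ℂ) : ℝ :=
  vnEntropy ρ - ∑ ω ∈ Finset.univ.filter (fun ω => 0 < outcomeProb V ρ ω),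
    outcomeProb V ρ ω * vnEntropy (postState V ρ ω)

/-- A pure state: a rank-one orthogonal projection. -/
def IsPureState {d : ℕ} (ρ : Matrix (Fin d) (Fin d) ℂ) : Prop :=
  ρ.IsHermitian ∧ ρ * ρ = ρ ∧ ρ.rank = 1

end
theorem qRelEntropy_eq_sub {d : ℕ} (ρ φ : Matrix (Fin d) (Fin d) ℂ) :
    qRelEntropy ρ φ = -vnEntropy ρ - (Matrix.trace (ρ * matLog φ)).re := by
  simp [qRelEntropy, vnEntropy, mul_sub, Matrix.trace_sub]

theorem sum_filter_pos_mul {X : Type*} [Fintype X] {p : X → ℝ} (hp : ∀ x, 0 ≤ p x)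
    (f : X → ℝ) :
    ∑ x ∈ Finset.univ.filter (fun x => 0 < p x), p x * f x = ∑ x, p x * f x := by
  refine Finset.sum_subset (Finset.filter_subset _ _) fun x _ hx => ?_
  have h : p x = 0 := le_antisymm (by simpa using hx) (hp x)
  simp [h]

/-- The χ-quantity is the entropy of the average state minus the average entropy. -/
theorem chiQuantity_eq_sub {d : ℕ} {X : Type*} [Fintype X] {p : X → ℝ} (hp : ∀ x, 0 ≤ p x)
    (σ : X → Matrix (Fin d) (Fin d) ℂ) :
    chiQuantity p σ = vnEntropy (∑ x, p x • σ x) - ∑ x, p x * vnEntropy (σ x) := by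
  have h (φ : Matrix (Fin d) (Fin d) ℂ) : (Matrix.trace ((∑ x, p x • σ x) * φ)).re =
      ∑ x, p x * (Matrix.trace (σ x * φ)).re := by
    simp [Finset.sum_mul, Matrix.trace_sum, Complex.re_sum]
  rw [chiQuantity, sum_filter_pos_mul hp]
  simp only [qRelEntropy_eq_sub, mul_sub, mul_neg, Finset.sum_sub_distrib,
    Finset.sum_neg_distrib]
  rw [← h, vnEntropy]
  ring

/-- Chain rule for the χ-quantity of an ensemble indexed by pairs. -/
theorem chiQuantity_prod {d : ℕ} {X Y : Type*} [Fintype X] [Fintype Y]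
    {q : X × Y → ℝ} (hq : ∀ z, 0 ≤ q z) (σ : X × Y → Matrix (Fin d) (Fin d) ℂ)
    {r : Y → ℝ} (hr : ∀ y, r y = ∑ x, q (x, y)) {τ : Y → Matrix (Fin d) (Fin d) ℂ}
    (hτ : ∀ y, r y • τ y = ∑ x, q (x, y) • σ (x, y)) :
    chiQuantity q σ = chiQuantity r τ +
      ∑ y ∈ Finset.univ.filter (fun y => 0 < r y),
        r y * chiQuantity (fun x => q (x, y) / r y) (fun x => σ (x, y)) := by
  have hr0 (y : Y) : 0 ≤ r y := hr y ▸ Finset.sum_nonneg fun x _ => hq _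
  have hcond (y : Y) : r y * chiQuantity (fun x => q (x, y) / r y) (fun x => σ (x, y)) =
      r y * vnEntropy (τ y) - ∑ x, q (x, y) * vnEntropy (σ (x, y)) := by
    rcases (hr0 y).eq_or_lt with h | h
    · have hz : ∀ x, q (x, y) = 0 := fun x =>
        (Finset.sum_eq_zero_iff_of_nonneg fun x _ => hq _).1 ((hr y).symm.trans h.symm) x
          (Finset.mem_univ x)
      simp [← h, hz]
    · have havg : ∑ x, (q (x, y) / r y) • σ (x, y) = τ y := by
        rw [← inv_smul_smul₀ h.ne' (τ y), hτ y, Finset.smul_sum]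
        simp only [smul_smul, div_eq_inv_mul]
      rw [chiQuantity_eq_sub fun x => div_nonneg (hq _) (hr0 y), havg, mul_sub, Finset.mul_sum]
      congr 1
      refine Finset.sum_congr rfl fun x _ => ?_
      field_simp
  rw [sum_filter_pos_mul hr0, chiQuantity_eq_sub hq, chiQuantity_eq_sub hr0]
  simp only [hcond, hτ, Finset.sum_sub_distrib, Fintype.sum_prod_type_right]
  ring

theorem trace_instrOp {d : ℕ} {Ω K : Type*} [Fintype K]
    (V : Ω → K → Matrix (Fin d) (Fin d) ℂ) (ω : Ω) (ρ : Matrix (Fin d) (Fin d) ℂ) :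
    (instrOp V ω ρ).trace = (instrPOV V ω * ρ).trace := by
  simp only [instrOp, instrPOV, Matrix.trace_sum, Finset.sum_mul]
  refine Finset.sum_congr rfl fun k _ => ?_
  rw [Matrix.trace_mul_comm, Matrix.mul_assoc]

theorem posSemidef_instrOp {d : ℕ} {Ω K : Type*} [Fintype K]
    (V : Ω → K → Matrix (Fin d) (Fin d) ℂ) (ω : Ω) {ρ : Matrix (Fin d) (Fin d) ℂ}
    (hρ : ρ.PosSemidef) : (instrOp V ω ρ).PosSemidef :=
  Matrix.posSemidef_sum _ fun k _ => hρ.mul_mul_conjTranspose_same (V ω k)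

theorem outcomeProb_nonneg {d : ℕ} {Ω K : Type*} [Fintype K]
    (V : Ω → K → Matrix (Fin d) (Fin d) ℂ) (ω : Ω) {ρ : Matrix (Fin d) (Fin d) ℂ}
    (hρ : ρ.PosSemidef) : 0 ≤ outcomeProb V ρ ω := by
  rw [outcomeProb, ← trace_instrOp]
  exact (Complex.nonneg_iff.1 (posSemidef_instrOp V ω hρ).trace_nonneg).1

theorem outcomeProb_smul_postState {d : ℕ} {Ω K : Type*} [Fintype K]
    (V : Ω → K → Matrix (Fin d) (Fin d) ℂ) (ω : Ω) {ρ : Matrix (Fin d) (Fin d) ℂ}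
    (hρ : ρ.PosSemidef) : outcomeProb V ρ ω • postState V ρ ω = instrOp V ω ρ := by
  by_cases h : outcomeProb V ρ ω = 0
  · have hps := posSemidef_instrOp V ω hρ
    have htr : (instrOp V ω ρ).trace = 0 :=
      Complex.ext (by rwa [trace_instrOp])
        (Complex.nonneg_iff.1 hps.trace_nonneg).2.symm
    rw [h, zero_smul, hps.trace_eq_zero_iff.1 htr]
  · exact smul_inv_smul₀ h _

theorem instrOp_sum_smul {d : ℕ} {A Ω K : Type*} [Fintype A] [Fintype K]
    (V : Ω → K → Matrix (Fin d) (Fin d) ℂ) (ω : Ω) (p : A → ℝ)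
    (ρ : A → Matrix (Fin d) (Fin d) ℂ) :
    instrOp V ω (∑ α, p α • ρ α) = ∑ α, p α • instrOp V ω (ρ α) := by
  simp only [instrOp, Finset.smul_sum, Finset.mul_sum, Finset.sum_mul, Matrix.mul_smul,
    Matrix.smul_mul]
  exact Finset.sum_comm

theorem outcomeProb_sum_smul {d : ℕ} {A Ω K : Type*} [Fintype A] [Fintype K]
    (V : Ω → K → Matrix (Fin d) (Fin d) ℂ) (ω : Ω) (p : A → ℝ)
    (ρ : A → Matrix (Fin d) (Fin d) ℂ) :
    outcomeProb V (∑ α, p α • ρ α) ω = ∑ α, p α * outcomeProb V (ρ α) ω := by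
  simp [outcomeProb, Finset.mul_sum, Matrix.trace_sum, Complex.re_sum]

/-- decomposition identity for the joint χ-quantity. -/
theorem chi_joint_decomposition {d : ℕ} (hd : 1 ≤ d)
    {A Ω K : Type*} [Fintype A] [Fintype Ω] [Fintype K]
    (p : A → ℝ) (hp : ∀ α, 0 ≤ p α) (hp1 : ∑ α, p α = 1)
    (ρ : A → Matrix (Fin d) (Fin d) ℂ)
    (hρ : ∀ α, (ρ α).PosSemidef) (hρtr : ∀ α, (ρ α).trace = 1)
    (V : Ω → K → Matrix (Fin d) (Fin d) ℂ)
    (hV : ∑ ω, instrPOV V ω = 1) :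
    let η := ∑ α, p α • ρ α
    let pf := fun ω => outcomeProb V η ω
    let pfi := fun ω α => outcomeProb V (ρ α) ω
    let ρf := fun α ω => (pfi ω α)⁻¹ • instrOp V ω (ρ α)
    let ρfbar := fun ω => (pf ω)⁻¹ • instrOp V ω η
    chiQuantity (fun x : A × Ω => p x.1 * pfi x.2 x.1) (fun x => ρf x.1 x.2) =
      chiQuantity pf ρfbar +
        ∑ ω ∈ Finset.univ.filter (fun ω => 0 < pf ω),
          pf ω * chiQuantity (fun α => p α * pfi ω α / pf ω) (fun α => ρf α ω) := by
  intro η pf pfi ρf ρfbar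
  have hη : η.PosSemidef := Matrix.posSemidef_sum _ fun α _ => (hρ α).smul (hp α)
  refine chiQuantity_prod (fun z => mul_nonneg (hp _) (outcomeProb_nonneg V _ (hρ _)))
    (fun x : A × Ω => ρf x.1 x.2) (fun ω => outcomeProb_sum_smul V ω p ρ) fun ω => ?_
  refine (outcomeProb_smul_postState V ω hη).trans ?_
  rw [instrOp_sum_smul]
  refine Finset.sum_congr rfl fun α _ => ?_
  rw [mul_smul]
  exact congrArg (p α • ·) (outcomeProb_smul_postState V ω (hρ α)).symm
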